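/- arXiv:2005.13533 — 3 statements merged into one kernel-verified Lean document; each statement's English description precedes it below -/
import Mathlib

section
/- Let d ≥ 1 and ε₁, ε₂, ε₃ ∈ (0,1) with 100·ε₃ ≤ ε₁·ε₂². Let F, T ∈ Matrix d d ℂ be Hermitian with operator norm ‖T‖ ≤ 1. Assume: every eigenvalue λ of F satisfies λ ∈ {−1} ∪ [−1+ε₁, 1−ε₁] ∪ {1}; the eigenspaces ker(F − 1) and ker(F + 1) are one-dimensional, spanned by unit vectors f₊ and f₋ respectively; ‖T·f₊‖ ≤ 1 − ε₂; and ‖(1 + T)·f₋‖ ≤ ε₃. Then there exists exactly one ζ₀ ∈ ℂ with |ζ₀ − 1| < 3ε₃ that is an eigenvalue of T·F, and this eigenvalue is non-degenerate in the strong sense that the kernel of (T·F − ζ₀·1)² has complex dimension 1. -/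
open Matrix

/-- The Euclidean norm of a vector in `ℂ^d`. -/
noncomputable def evnorm {d : ℕ} (v : Fin d → ℂ) : ℝ :=
  Real.sqrt (∑ i, ‖v i‖ ^ 2)

/-- The operator norm of a matrix induced by the Euclidean norm on `ℂ^d`. -/
noncomputable def matOpNorm {d : ℕ} (A : Matrix (Fin d) (Fin d) ℂ) : ℝ :=
  sSup {r : ℝ | ∃ v : Fin d → ℂ, evnorm v ≤ 1 ∧ r = evnorm (A.mulVec v)}

lemma schur_solve {E : Type*} [NormedAddCommGroup E] [InnerProductSpace ℂ E]
    [FiniteDimensional ℂ E] (L : E →ₗ[ℂ] E) (f : E) (ζ : ℂ) (hζ : ζ ≠ 0)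
    (c : ℝ) (hc : 0 < c)
    (hL : ∀ x, inner ℂ f (L x) = 0)
    (hB : ∀ v, inner ℂ f v = 0 → c * ‖v‖ ≤ ‖L v - ζ • v‖)
    (g : E) (hg : inner ℂ f g = 0) : ∃ v, inner ℂ f v = 0 ∧ L v - ζ • v = g := by
  have hinj : Function.Injective (L - ζ • LinearMap.id : E →ₗ[ℂ] E) := by
    rw [← LinearMap.ker_eq_bot, LinearMap.ker_eq_bot']
    intro x hx
    simp only [LinearMap.sub_apply, LinearMap.smul_apply, LinearMap.id_apply] at hx
    have h1 : inner ℂ f x = 0 := by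
      have := congrArg (fun y => inner ℂ f y) hx
      simpa [inner_sub_right, hL, inner_smul_right, hζ] using this
    have h2 := hB x h1
    rw [hx, norm_zero] at h2
    have : ‖x‖ ≤ 0 := by
      by_contra! h
      nlinarith [mul_pos hc h]
    simpa using this
  obtain ⟨v, hv⟩ := (LinearMap.injective_iff_surjective.mp hinj) g
  simp only [LinearMap.sub_apply, LinearMap.smul_apply, LinearMap.id_apply] at hv
  refine ⟨v, ?_, hv⟩
  have := congrArg (fun y => inner ℂ f y) hv
  simpa [inner_sub_right, hL, inner_smul_right, hζ, hg] using this

lemma schur_abs {E : Type*} [NormedAddCommGroup E] [InnerProductSpace ℂ E]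
    [FiniteDimensional ℂ E] (A : E →ₗ[ℂ] E) (f : E) (hf : ‖f‖ = 1) (δ : ℝ) (hδ : 0 < δ)
    (hδ1 : δ < 1 / 100)
    (h1 : ∀ v, inner ℂ f v = 0 → 25 * δ * ‖v‖ ≤ ‖v - (A v - (inner ℂ f (A v)) • f)‖)
    (e : E) (he : ‖e‖ ≤ δ) (h2 : A f = f - e)
    (h3 : ∀ v, inner ℂ f v = 0 → ‖inner ℂ f (A v)‖ ≤ δ * ‖v‖) :
    ∃ ζ₀ : ℂ, ‖ζ₀ - 1‖ < 3 * δ ∧ (∃ u, u ≠ 0 ∧ A u = ζ₀ • u) ∧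
      (∀ ζ : ℂ, ‖ζ - 1‖ < 3 * δ → (∃ u, u ≠ 0 ∧ A u = ζ • u) → ζ = ζ₀) ∧
      ∃ u, u ≠ 0 ∧ ∀ w, A (A w - ζ₀ • w) - ζ₀ • (A w - ζ₀ • w) = 0 ↔ ∃ c : ℂ, w = c • u := by
  have hff : inner ℂ f f = (1 : ℂ) := by
    rw [inner_self_eq_norm_sq_to_K, hf]; simp
  have hf0 : f ≠ 0 := by intro h; simp [h] at hf
  let Q : E →ₗ[ℂ] E := LinearMap.id - ((innerSL ℂ f).smulRight f : E →L[ℂ] E).toLinearMap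
  have Qd : ∀ x, Q x = x - (inner ℂ f x) • f := fun x => by simp [Q]
  have Qi : ∀ x, inner ℂ f (Q x) = (0 : ℂ) := fun x => by
    rw [Qd, inner_sub_right, inner_smul_right, hff]; ring
  have Qf : Q f = 0 := by rw [Qd, hff]; simp
  have Qp : ∀ x, inner ℂ f x = (0 : ℂ) → Q x = x := fun x hx => by rw [Qd, hx]; simp
  have Qdec : ∀ x, x = (inner ℂ f x) • f + Q x := fun x => by rw [Qd]; abel
  have Qn : ∀ x, ‖Q x‖ ≤ ‖x‖ := fun x => by
    have h : inner ℂ ((inner ℂ f x) • f) (Q x) = (0 : ℂ) := by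
      rw [inner_smul_left, Qi]; simp
    have := norm_add_sq_eq_norm_sq_add_norm_sq_of_inner_eq_zero _ _ h
    rw [← Qdec] at this
    nlinarith [norm_nonneg x, norm_nonneg (Q x), norm_nonneg ((inner ℂ f x) • f)]
  have hB : ∀ ζ : ℂ, ‖ζ - 1‖ ≤ 3 * δ → ∀ v, inner ℂ f v = (0 : ℂ) →
      22 * δ * ‖v‖ ≤ ‖Q (A v) - ζ • v‖ := by
    intro ζ hζ v hv
    have a := h1 v hv
    rw [← Qd] at a
    have b : v - Q (A v) = (ζ • v - Q (A v)) - (ζ - 1) • v := by module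
    have c : ‖v - Q (A v)‖ ≤ ‖ζ • v - Q (A v)‖ + ‖ζ - 1‖ * ‖v‖ := by
      rw [b, ← norm_smul]; exact norm_sub_le _ _
    rw [norm_sub_rev (ζ • v)] at c
    nlinarith [norm_nonneg v]
  have hne : ∀ ζ : ℂ, ‖ζ - 1‖ ≤ 3 * δ → ζ ≠ 0 := by
    rintro ζ hζ rfl
    simp at hζ; linarith
  have hz : ∀ ζ : ℂ, ‖ζ - 1‖ ≤ 3 * δ → ∀ v, inner ℂ f v = (0 : ℂ) → Q (A v) - ζ • v = 0 →
      v = 0 := by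
    intro ζ hζ v hv h
    have := hB ζ hζ v hv
    rw [h, norm_zero] at this
    have : ‖v‖ ≤ 0 := by
      by_contra! h
      nlinarith [mul_pos hδ h]
    simpa using this
  have hsol : ∀ ζ : ℂ, ∃ v, ‖ζ - 1‖ ≤ 3 * δ →
      inner ℂ f v = (0 : ℂ) ∧ Q (A v) - ζ • v = Q e := by
    intro ζ
    by_cases hζ : ‖ζ - 1‖ ≤ 3 * δ
    · obtain ⟨v, hv⟩ := schur_solve (Q ∘ₗ A) f ζ (hne ζ hζ) (22 * δ) (by positivity)
        (fun x => Qi _) (hB ζ hζ) (Q e) (Qi e)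
      exact ⟨v, fun _ => hv⟩
    · exact ⟨0, fun h => absurd h hζ⟩
  choose V hV using hsol
  have hVn : ∀ ζ : ℂ, ‖ζ - 1‖ ≤ 3 * δ → ‖V ζ‖ ≤ 1 / 22 := by
    intro ζ hζ
    obtain ⟨a, b⟩ := hV ζ hζ
    have c := hB ζ hζ _ a
    rw [b] at c
    have : 22 * δ * ‖V ζ‖ ≤ δ := c.trans ((Qn e).trans he)
    by_contra! h
    nlinarith
  let Φ : ℂ → ℂ := fun ζ => 1 - inner ℂ f e + inner ℂ f (A (V ζ))
  have hfe : ‖(inner ℂ f e : ℂ)‖ ≤ δ := by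
    have := norm_inner_le_norm (𝕜 := ℂ) f e
    rw [hf, one_mul] at this; exact this.trans he
  have hΦ : ∀ ζ : ℂ, ‖ζ - 1‖ ≤ 3 * δ → ‖Φ ζ - 1‖ ≤ 2 * δ := by
    intro ζ hζ
    have : Φ ζ - 1 = inner ℂ f (A (V ζ)) - inner ℂ f e := by simp only [Φ]; ring
    rw [this]
    have a := norm_sub_le (inner ℂ f (A (V ζ)) : ℂ) (inner ℂ f e)
    have b := h3 _ (hV ζ hζ).1
    have c := hVn ζ hζ
    nlinarith
  have hLip : ∀ ζ ζ' : ℂ, ‖ζ - 1‖ ≤ 3 * δ → ‖ζ' - 1‖ ≤ 3 * δ →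
      ‖Φ ζ - Φ ζ'‖ ≤ 1 / 2 * ‖ζ - ζ'‖ := by
    intro ζ ζ' hζ hζ'
    obtain ⟨a, b⟩ := hV ζ hζ
    obtain ⟨a', b'⟩ := hV ζ' hζ'
    have a2 : inner ℂ f (V ζ - V ζ') = (0 : ℂ) := by rw [inner_sub_right, a, a', sub_zero]
    have e1 : Φ ζ - Φ ζ' = inner ℂ f (A (V ζ - V ζ')) := by
      simp only [Φ, map_sub, inner_sub_right]; ring
    have e2 : Q (A (V ζ - V ζ')) - ζ • (V ζ - V ζ') = (ζ - ζ') • V ζ' := by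
      have : Q (A (V ζ - V ζ')) - ζ • (V ζ - V ζ') =
        (Q (A (V ζ)) - ζ • V ζ) - (Q (A (V ζ')) - ζ' • V ζ') + (ζ - ζ') • V ζ' := by
        simp only [map_sub]; module
      rw [this, b, b']; simp
    have c := hB ζ hζ _ a2
    rw [e2, norm_smul] at c
    have c2 := h3 _ a2
    rw [e1]
    have := hVn ζ' hζ'
    nlinarith [norm_nonneg (ζ - ζ')]
  -- fixed point
  obtain ⟨ζ₀, hζ₀, hfix⟩ : ∃ ζ₀ : ℂ, ‖ζ₀ - 1‖ ≤ 3 * δ ∧ Φ ζ₀ = ζ₀ := by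
    have hmem : ∀ ζ, ζ ∈ Metric.closedBall (1 : ℂ) (3 * δ) ↔ ‖ζ - 1‖ ≤ 3 * δ := fun ζ => by
      rw [Metric.mem_closedBall, dist_eq_norm]
    have hmaps : Set.MapsTo Φ (Metric.closedBall (1 : ℂ) (3 * δ))
        (Metric.closedBall (1 : ℂ) (3 * δ)) := by
      intro ζ hζ
      rw [hmem] at hζ ⊢
      linarith [hΦ ζ hζ]
    have hcon : ContractingWith (1 / 2) (hmaps.restrict Φ _ _) := by
      refine ⟨by norm_num, LipschitzWith.of_dist_le_mul ?_⟩
      rintro ⟨x, hx⟩ ⟨y, hy⟩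
      rw [hmem] at hx hy
      have := hLip x y hx hy
      simpa [Subtype.dist_eq, dist_eq_norm] using this
    have h1m : (1 : ℂ) ∈ Metric.closedBall (1 : ℂ) (3 * δ) := by
      rw [hmem]; simp; positivity
    obtain ⟨y, hy, hy2, -⟩ := hcon.exists_fixedPoint' (Metric.isClosed_closedBall.isComplete)
      hmaps h1m (edist_ne_top _ _)
    exact ⟨y, (hmem y).1 hy, hy2⟩
  obtain ⟨v0, v1⟩ := hV ζ₀ hζ₀
  have hv0 : ‖V ζ₀‖ ≤ 1 / 22 := hVn ζ₀ hζ₀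
  set v := V ζ₀ with hv
  have hfu : inner ℂ f (f + v) = (1 : ℂ) := by rw [inner_add_right, hff, v0, add_zero]
  have hu0 : f + v ≠ 0 := by
    intro h; rw [h] at hfu; simp at hfu
  have hAu : A (f + v) = ζ₀ • (f + v) := by
    rw [Qdec (A (f + v))]
    have : inner ℂ f (A (f + v)) = ζ₀ := by
      rw [map_add, h2, inner_add_right, inner_sub_right, hff]; exact hfix
    rw [this]
    have : Q (A (f + v)) = ζ₀ • v := by
      have h := sub_eq_iff_eq_add.1 v1
      rw [map_add, h2, map_add, map_sub, Qf, h]; abel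
    rw [this, smul_add]
  refine ⟨ζ₀, ?_, ⟨f + v, hu0, hAu⟩, ?_, f + v, hu0, ?_⟩
  · rw [← hfix]; linarith [hΦ ζ₀ hζ₀]
  · rintro ζ hζ ⟨u, hu, hu2⟩
    replace hζ := hζ.le
    obtain ⟨w0, w1⟩ := hV ζ hζ
    -- decompose
    have hx : (inner ℂ f u : ℂ) ≠ 0 := by
      intro h
      apply hu
      apply hz ζ hζ u h
      rw [hu2, map_smul, Qp u h, sub_self]
    set x : ℂ := inner ℂ f u with hxd
    have hp : x⁻¹ • Q u = V ζ := by
      rw [← sub_eq_zero]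
      have hi : inner ℂ f (x⁻¹ • Q u - V ζ) = (0 : ℂ) := by
        rw [inner_sub_right, inner_smul_right, Qi, w0]; simp
      apply hz ζ hζ _ hi
      have h5 : Q (A (Q u)) = ζ • Q u + x • Q e := by
        have : Q u = u - x • f := Qd u
        have h6 : A (Q u) = ζ • u - x • (f - e) := by rw [this, map_sub, map_smul, hu2, h2]
        rw [h6, map_sub, map_smul, map_smul, map_sub, Qf]; module
      have h7 : Q (A (x⁻¹ • Q u - V ζ)) - ζ • (x⁻¹ • Q u - V ζ) =
        x⁻¹ • (Q (A (Q u)) - ζ • Q u) - (Q (A (V ζ)) - ζ • V ζ) := by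
        simp only [map_sub, map_smul]; module
      rw [h7, w1, h5, add_sub_cancel_left, smul_smul, inv_mul_cancel₀ hx, one_smul, sub_self]
    have hfixζ : Φ ζ = ζ := by
      have h8 : u = x • (f + V ζ) := by
        rw [← hp, smul_add, smul_smul, mul_inv_cancel₀ hx, one_smul]; exact Qdec u
      have h9 : inner ℂ f (A u) = ζ * x := by rw [hu2, inner_smul_right]
      rw [h8, map_smul, inner_smul_right, map_add, h2, inner_add_right, inner_sub_right, hff] at h9
      have : x * Φ ζ = x * ζ := by rw [mul_comm x ζ, ← h9]
      exact mul_left_cancel₀ hx this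
    have := hLip ζ ζ₀ hζ hζ₀
    rw [hfix, hfixζ] at this
    have h : ‖ζ - ζ₀‖ ≤ 0 := by linarith
    exact sub_eq_zero.1 (norm_le_zero_iff.1 h)
  · intro w
    constructor
    · intro hw
      have hker : ∀ x, A x - ζ₀ • x = 0 → x = (inner ℂ f x) • (f + v) := by
        intro x hx
        rw [← sub_eq_zero]
        have hi : inner ℂ f (x - (inner ℂ f x) • (f + v)) = (0 : ℂ) := by
          rw [inner_sub_right, inner_smul_right, hfu]; ring
        apply hz ζ₀ hζ₀ _ hi
        have : A (x - (inner ℂ f x) • (f + v)) = ζ₀ • (x - (inner ℂ f x) • (f + v)) := by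
          rw [map_sub, map_smul, hAu, sub_eq_zero.1 hx]; module
        rw [this, map_smul, Qp _ hi, sub_self]
      have h4 := hker _ hw
      set c : ℂ := inner ℂ f (A w - ζ₀ • w) with hc
      set w' := w - (inner ℂ f w) • (f + v) with hw'
      have hi : inner ℂ f w' = (0 : ℂ) := by
        rw [hw', inner_sub_right, inner_smul_right, hfu]; ring
      have h5 : A w' = ζ₀ • w' + c • (f + v) := by
        rw [← h4, hw', map_sub, map_smul, hAu]; module
      have h6 : Q (A w') - ζ₀ • w' = c • v := by
        rw [h5, map_add, map_smul, map_smul, map_add, Qf, Qp _ hi, Qp _ v0]; module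
      have h7 : inner ℂ f (A w') = c := by
        rw [h5, inner_add_right, inner_smul_right, inner_smul_right, hi, hfu]; ring
      have h8 := hB ζ₀ hζ₀ _ hi
      have h9 := h3 _ hi
      rw [h7] at h9
      rw [h6, norm_smul] at h8
      have h10 : ‖w'‖ ≤ 0 := by
        by_contra! h
        have : ‖c‖ * ‖v‖ ≤ δ * ‖w'‖ * (1 / 22) :=
          mul_le_mul h9 hv0 (norm_nonneg _) (by positivity)
        nlinarith [mul_pos hδ h]
      exact ⟨_, sub_eq_zero.1 (norm_le_zero_iff.1 h10)⟩
    · rintro ⟨c, rfl⟩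
      have : A (c • (f + v)) - ζ₀ • c • (f + v) = 0 := by
        rw [map_smul, hAu]; module
      rw [this]; simp

lemma spec_bound {E : Type*} [NormedAddCommGroup E] [InnerProductSpace ℂ E]
    [FiniteDimensional ℂ E] (F : E →ₗ[ℂ] E) (hF : F.IsSymmetric) (r : ℝ) (hr : 0 ≤ r) (w : E)
    (h : ∀ (μ : ℝ) (v : E), v ≠ 0 → F v = (μ : ℂ) • v → |μ| ≤ r ∨ inner ℂ v w = (0 : ℂ)) :
    ‖F w‖ ≤ r * ‖w‖ := by
  let b := hF.eigenvectorBasis rfl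
  have h1 : ‖F w‖ ^ 2 ≤ (r * ‖w‖) ^ 2 := by
    rw [mul_pow, ← b.sum_sq_norm_inner_right (F w), ← b.sum_sq_norm_inner_right w, Finset.mul_sum]
    apply Finset.sum_le_sum
    intro i _
    have e1 : F (b i) = ((hF.eigenvalues rfl i : ℝ) : ℂ) • b i := hF.apply_eigenvectorBasis rfl i
    have e2 : inner ℂ (b i) (F w) = ((hF.eigenvalues rfl i : ℝ) : ℂ) * inner ℂ (b i) w := by
      rw [← hF, e1, inner_smul_left]; simp
    have hb : b i ≠ 0 := b.orthonormal.ne_zero i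
    rw [e2, norm_mul, mul_pow]
    rcases h _ _ hb e1 with h | h
    · rw [Complex.norm_real, Real.norm_eq_abs]
      gcongr
    · rw [h]; simp
  exact (sq_le_sq₀ (norm_nonneg _) (by positivity)).1 h1

lemma real_core {ε₁ ε₂ ε₃ D n m k l a z : ℝ} (p1 : 0 < ε₁) (q1 : ε₁ < 1) (p2 : 0 < ε₂)
    (q2 : ε₂ < 1) (hεs : 100 * ε₃ ≤ ε₁ * ε₂ ^ 2) (hyn : n - D ≤ z) (hvn : n ^ 2 = a ^ 2 + m ^ 2)
    (hFvn : l ^ 2 = a ^ 2 + k ^ 2) (hw1 : k ≤ (1 - ε₁) * m) (hy1 : z ≤ l)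
    (hy2 : z ≤ a * (1 - ε₂) + (1 - ε₁) * m) (ha : a ≤ n) (hD0 : 0 ≤ D) (hn : 0 ≤ n)
    (hwn : 0 ≤ m) (hFwn : 0 ≤ k) (hle : l ≤ n) : 25 * ε₃ * n ≤ D := by
  by_contra! hlt
  have hnpos : 0 < n := by
    by_contra! h
    have : n = 0 := le_antisymm h hn
    rw [this] at hlt; linarith
  have hD1 : D < ε₁ * ε₂ ^ 2 / 4 * n := by
    have : 25 * ε₃ * n ≤ ε₁ * ε₂ ^ 2 / 4 * n := by gcongr; linarith
    linarith
  have hk : k ^ 2 ≤ (1 - ε₁) * m ^ 2 := by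
    have h1 : k ^ 2 ≤ ((1 - ε₁) * m) ^ 2 := by gcongr
    have h2 := mul_nonneg (mul_nonneg p1.le (sub_nonneg.2 q1.le)) (sq_nonneg m)
    linarith
  have hm1 : ε₁ * m ^ 2 ≤ 2 * D * n := by
    have h1 : ε₁ * m ^ 2 ≤ n ^ 2 - l ^ 2 := by linarith
    have h2 : (n - l) * (n + l) ≤ (n - l) * (2 * n) :=
      mul_le_mul_of_nonneg_left (by linarith) (by linarith)
    have h3 : (n - l) * (2 * n) ≤ D * (2 * n) :=
      mul_le_mul_of_nonneg_right (by linarith) (by linarith)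
    linarith
  have hm2 : m ^ 2 < (ε₂ * n * (72 / 100)) ^ 2 := by
    have h1 := mul_lt_mul_of_pos_right hD1 hnpos
    have h2 : ε₁ * m ^ 2 < ε₁ * (ε₂ ^ 2 / 2 * n ^ 2) := by linarith
    have h3 := lt_of_mul_lt_mul_left h2 p1.le
    have h4 := mul_pos (pow_pos p2 2) (pow_pos hnpos 2)
    linarith
  have hm3 : m < ε₂ * n * (72 / 100) := lt_of_pow_lt_pow_left₀ 2 (by positivity) hm2
  have hD2 : D < ε₂ / 4 * n := by
    have h0 : ε₁ * ε₂ ^ 2 ≤ 1 * ε₂ := by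
      apply mul_le_mul q1.le _ (by positivity) zero_le_one
      nlinarith
    have : ε₁ * ε₂ ^ 2 / 4 * n ≤ ε₂ / 4 * n := by gcongr; linarith
    linarith
  have h5 : a * (1 - ε₂) ≤ n * (1 - ε₂) := mul_le_mul_of_nonneg_right ha (by linarith)
  have h6 := mul_nonneg p1.le hwn
  have h7 := mul_pos p2 hnpos
  linarith

lemma main_abs {E : Type*} [NormedAddCommGroup E] [InnerProductSpace ℂ E]
    [FiniteDimensional ℂ E] (F T : E →ₗ[ℂ] E) (hF : F.IsSymmetric) (hT : T.IsSymmetric)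
    (ε₁ ε₂ ε₃ : ℝ)
    (hε₁ : ε₁ ∈ Set.Ioo (0 : ℝ) 1) (hε₂ : ε₂ ∈ Set.Ioo (0 : ℝ) 1)
    (hε₃ : ε₃ ∈ Set.Ioo (0 : ℝ) 1)
    (hεs : 100 * ε₃ ≤ ε₁ * ε₂ ^ 2)
    (hTn : ∀ v, ‖T v‖ ≤ ‖v‖)
    (hspec : ∀ μ : ℝ, (∃ v, v ≠ 0 ∧ F v = (μ : ℂ) • v) →
      μ = -1 ∨ (-1 + ε₁ ≤ μ ∧ μ ≤ 1 - ε₁) ∨ μ = 1)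
    (fp fm : E)
    (hfp : F fp = fp) (hfm : F fm = -fm)
    (hfpnorm : ‖fp‖ = 1) (hfmnorm : ‖fm‖ = 1)
    (hkerp : ∀ v, F v = v → ∃ c : ℂ, v = c • fp)
    (hkerm : ∀ v, F v = -v → ∃ c : ℂ, v = c • fm)
    (hTfp : ‖T fp‖ ≤ 1 - ε₂)
    (hTfm : ‖fm + T fm‖ ≤ ε₃) :
    ∃ ζ₀ : ℂ, ‖ζ₀ - 1‖ < 3 * ε₃ ∧ (∃ u, u ≠ 0 ∧ T (F u) = ζ₀ • u) ∧
      (∀ ζ : ℂ, ‖ζ - 1‖ < 3 * ε₃ → (∃ u, u ≠ 0 ∧ T (F u) = ζ • u) → ζ = ζ₀) ∧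
      ∃ u, u ≠ 0 ∧ ∀ w, T (F (T (F w) - ζ₀ • w)) - ζ₀ • (T (F w) - ζ₀ • w) = 0 ↔
        ∃ c : ℂ, w = c • u := by
  obtain ⟨p1, q1⟩ := hε₁
  obtain ⟨p2, q2⟩ := hε₂
  obtain ⟨p3, q3⟩ := hε₃
  have hFn : ∀ v, ‖F v‖ ≤ ‖v‖ := by
    intro w
    have := spec_bound F hF 1 zero_le_one w (fun μ v hv hv2 => Or.inl (by
      rw [abs_le]
      rcases hspec μ ⟨v, hv, hv2⟩ with h | h | h
      · constructor <;> linarith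
      · constructor <;> linarith
      · constructor <;> linarith))
    simpa using this
  have hFw : ∀ w, inner ℂ fm w = (0 : ℂ) → inner ℂ fp w = (0 : ℂ) →
      ‖F w‖ ≤ (1 - ε₁) * ‖w‖ := by
    intro w hm hp
    apply spec_bound F hF _ (by linarith)
    intro μ v hv hv2
    rcases hspec μ ⟨v, hv, hv2⟩ with h | h | h
    · right
      obtain ⟨c, rfl⟩ := hkerm v (by rw [hv2, h]; simp)
      rw [inner_smul_left, hm, mul_zero]
    · left; rw [abs_le]; constructor <;> linarith
    · right
      obtain ⟨c, rfl⟩ := hkerp v (by rw [hv2, h]; simp)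
      rw [inner_smul_left, hp, mul_zero]
  have hpp : inner ℂ fp fp = (1 : ℂ) := by
    rw [inner_self_eq_norm_sq_to_K, hfpnorm]; simp
  have hmm : inner ℂ fm fm = (1 : ℂ) := by
    rw [inner_self_eq_norm_sq_to_K, hfmnorm]; simp
  have hmp : inner ℂ fm fp = (0 : ℂ) := by
    have h := hF fm fp
    rw [hfm, hfp, inner_neg_left] at h
    have : (2 : ℂ) * inner ℂ fm fp = 0 := by linear_combination -h
    simpa using this
  have hsm : ε₃ < 1 / 100 := by nlinarith [mul_pos p1 p2]
  apply schur_abs (T ∘ₗ F) fm hfmnorm ε₃ p3 hsm (e := fm + T fm)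
  · -- main bound
    intro v hv
    simp only [LinearMap.comp_apply]
    set y := T (F v) with hy
    -- ‖v‖ - ‖projected‖ ≤ ‖y‖
    set D := ‖v - (y - (inner ℂ fm y : ℂ) • fm)‖ with hD
    have hyn : ‖v‖ - D ≤ ‖y‖ := by
      have h0 : inner ℂ ((inner ℂ fm y : ℂ) • fm) (y - (inner ℂ fm y : ℂ) • fm) = (0 : ℂ) := by
        rw [inner_smul_left, inner_sub_right, inner_smul_right, hmm]; ring
      have h00 := norm_add_sq_eq_norm_sq_add_norm_sq_of_inner_eq_zero _ _ h0
      rw [add_sub_cancel] at h00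
      have h01 : ‖y - (inner ℂ fm y : ℂ) • fm‖ ≤ ‖y‖ := by
        nlinarith [norm_nonneg y, norm_nonneg (y - (inner ℂ fm y : ℂ) • fm),
          norm_nonneg ((inner ℂ fm y : ℂ) • fm)]
      have := norm_sub_norm_le v (y - (inner ℂ fm y : ℂ) • fm)
      linarith
    set α : ℂ := inner ℂ fp v with hα
    set w := v - α • fp with hw
    have hvd : v = α • fp + w := by rw [hw]; abel
    have hwp : inner ℂ fp w = (0 : ℂ) := by
      rw [hw, inner_sub_right, inner_smul_right, hpp]; ring
    have hwm : inner ℂ fm w = (0 : ℂ) := by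
      rw [hw, inner_sub_right, inner_smul_right, hmp, hv]; ring
    have hvn : ‖v‖ ^ 2 = ‖α‖ ^ 2 + ‖w‖ ^ 2 := by
      have h0 : inner ℂ (α • fp) w = (0 : ℂ) := by rw [inner_smul_left, hwp, mul_zero]
      have := norm_add_sq_eq_norm_sq_add_norm_sq_of_inner_eq_zero _ _ h0
      rw [← hvd, norm_smul, hfpnorm] at this
      nlinarith
    have hFv : F v = α • fp + F w := by
      conv_lhs => rw [hvd]
      rw [map_add, map_smul, hfp]
    have hFvn : ‖F v‖ ^ 2 = ‖α‖ ^ 2 + ‖F w‖ ^ 2 := by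
      have h0 : inner ℂ (α • fp) (F w) = (0 : ℂ) := by
        rw [inner_smul_left, ← hF, hfp, hwp, mul_zero]
      have := norm_add_sq_eq_norm_sq_add_norm_sq_of_inner_eq_zero _ _ h0
      rw [← hFv, norm_smul, hfpnorm] at this
      nlinarith
    have hw1 := hFw w hwm hwp
    have hy1 : ‖y‖ ≤ ‖F v‖ := hTn _
    have hy2 : ‖y‖ ≤ ‖α‖ * (1 - ε₂) + (1 - ε₁) * ‖w‖ := by
      rw [hy, hFv, map_add, map_smul]
      refine (norm_add_le _ _).trans ?_
      rw [norm_smul]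
      have := (hTn (F w)).trans hw1
      gcongr
    have ha : ‖α‖ ≤ ‖v‖ := by
      nlinarith [norm_nonneg v, norm_nonneg α, sq_nonneg ‖w‖]
    have hD0 : 0 ≤ D := norm_nonneg _
    clear_value D
    have hn := norm_nonneg v
    have hwn := norm_nonneg w
    have hFwn := norm_nonneg (F w)
    have hFvn0 := norm_nonneg (F v)
    have hle := hFn v
    exact real_core p1 q1 p2 q2 hεs hyn hvn hFvn hw1 hy1 hy2 ha hD0 hn hwn hFwn hle
  · exact hTfm
  · simp [hfm]
  · intro v hv
    have h : inner ℂ fm ((T ∘ₗ F) v) = inner ℂ (fm + T fm) (F v) := by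
      have h0 : inner ℂ fm (F v) = (0 : ℂ) := by
        rw [← hF, hfm, inner_neg_left, hv, neg_zero]
      rw [inner_add_left, h0, zero_add, hT]; rfl
    rw [h]
    refine (norm_inner_le_norm _ _).trans ?_
    gcongr
    exact hFn v

lemma evnorm_eq {d : ℕ} (v : Fin d → ℂ) : evnorm v = ‖(WithLp.toLp 2 v : EuclideanSpace ℂ (Fin d))‖ := by
  rw [evnorm, EuclideanSpace.norm_eq]

lemma matOpNorm_bound {d : ℕ} (T : Matrix (Fin d) (Fin d) ℂ) (h : matOpNorm T ≤ 1)
    (x : EuclideanSpace ℂ (Fin d)) : ‖Matrix.toEuclideanLin T x‖ ≤ ‖x‖ := by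
  let C : EuclideanSpace ℂ (Fin d) →L[ℂ] EuclideanSpace ℂ (Fin d) :=
    LinearMap.toContinuousLinearMap (Matrix.toEuclideanLin T)
  have hev : ∀ v : Fin d → ℂ, evnorm (T.mulVec v) = ‖C (WithLp.toLp 2 v)‖ := by
    intro v
    rw [evnorm_eq]; rfl
  have hbdd : BddAbove {r : ℝ | ∃ v : Fin d → ℂ, evnorm v ≤ 1 ∧ r = evnorm (T.mulVec v)} := by
    refine ⟨‖C‖, ?_⟩
    rintro r ⟨v, hv, rfl⟩
    rw [hev]
    rw [evnorm_eq] at hv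
    exact C.unit_le_opNorm _ hv
  by_cases hx : x = 0
  · simp [hx]
  have hx' : ‖x‖ ≠ 0 := by simpa using hx
  let y : EuclideanSpace ℂ (Fin d) := ((‖x‖⁻¹ : ℝ) : ℂ) • x
  have hy : ‖y‖ = 1 := by
    simp only [y, norm_smul, Complex.norm_real, norm_inv, norm_norm]
    exact inv_mul_cancel₀ hx'
  have h1 : ‖C y‖ ≤ 1 := by
    refine le_trans (le_csSup hbdd ⟨y.ofLp, ?_, ?_⟩) h
    · rw [evnorm_eq]; exact hy.le
    · rw [hev]
  have h2 : C y = ((‖x‖⁻¹ : ℝ) : ℂ) • C x := map_smul _ _ _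
  rw [h2, norm_smul, Complex.norm_real, norm_inv, norm_norm,
    inv_mul_le_iff₀ (by positivity), mul_one] at h1
  exact h1

lemma not_isUnit_iff {d : ℕ} (M : Matrix (Fin d) (Fin d) ℂ) (ζ : ℂ) :
    ¬ IsUnit (M - ζ • (1 : Matrix (Fin d) (Fin d) ℂ)) ↔
      ∃ u : EuclideanSpace ℂ (Fin d), u ≠ 0 ∧ Matrix.toEuclideanLin M u = ζ • u := by
  rw [Matrix.isUnit_iff_isUnit_det, isUnit_iff_ne_zero, not_not, ← Matrix.exists_mulVec_eq_zero_iff]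
  constructor
  · rintro ⟨v, hv, hv2⟩
    refine ⟨WithLp.toLp 2 v, by simpa using hv, ?_⟩
    rw [Matrix.sub_mulVec, Matrix.smul_mulVec, Matrix.one_mulVec, sub_eq_zero] at hv2
    rw [Matrix.toLpLin_toLp, Matrix.toLin'_apply, hv2]; rfl
  · rintro ⟨u, hu, hu2⟩
    refine ⟨u.ofLp, by simpa using hu, ?_⟩
    rw [Matrix.sub_mulVec, Matrix.smul_mulVec, Matrix.one_mulVec, sub_eq_zero]
    exact congrArg WithLp.ofLp hu2

/-- The non-degeneracy statement (C.11) of the TF-Stability Lemma: `T·F` has exactly one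
eigenvalue `ζ₀` with `|ζ₀ − 1| < 3ε₃`, and `ker (T·F − ζ₀)²` is one-dimensional. -/
theorem TF_stability_nondegeneracy
    (d : ℕ) (hd : 1 ≤ d)
    (ε₁ ε₂ ε₃ : ℝ)
    (hε₁ : ε₁ ∈ Set.Ioo (0 : ℝ) 1) (hε₂ : ε₂ ∈ Set.Ioo (0 : ℝ) 1)
    (hε₃ : ε₃ ∈ Set.Ioo (0 : ℝ) 1)
    (hεs : 100 * ε₃ ≤ ε₁ * ε₂ ^ 2)
    (F T : Matrix (Fin d) (Fin d) ℂ)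
    (hF : F.IsHermitian) (hT : T.IsHermitian)
    (hTnorm : matOpNorm T ≤ 1)
    (hspec : ∀ μ : ℝ, (∃ v : Fin d → ℂ, v ≠ 0 ∧ F.mulVec v = (μ : ℂ) • v) →
      μ = -1 ∨ (-1 + ε₁ ≤ μ ∧ μ ≤ 1 - ε₁) ∨ μ = 1)
    (fp fm : Fin d → ℂ)
    (hfp : F.mulVec fp = fp) (hfm : F.mulVec fm = -fm)
    (hfpnorm : evnorm fp = 1) (hfmnorm : evnorm fm = 1)
    (hkerp : ∀ v : Fin d → ℂ, F.mulVec v = v → ∃ c : ℂ, v = c • fp)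
    (hkerm : ∀ v : Fin d → ℂ, F.mulVec v = -v → ∃ c : ℂ, v = c • fm)
    (hTfp : evnorm (T.mulVec fp) ≤ 1 - ε₂)
    (hTfm : evnorm (((1 : Matrix (Fin d) (Fin d) ℂ) + T).mulVec fm) ≤ ε₃) :
    ∃ ζ₀ : ℂ,
      (‖ζ₀ - 1‖ < 3 * ε₃ ∧ ¬ IsUnit (T * F - ζ₀ • (1 : Matrix (Fin d) (Fin d) ℂ)))
      ∧ (∀ ζ : ℂ, ‖ζ - 1‖ < 3 * ε₃ →
          ¬ IsUnit (T * F - ζ • (1 : Matrix (Fin d) (Fin d) ℂ)) → ζ = ζ₀)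
      ∧ Module.finrank ℂ
          (LinearMap.ker (Matrix.toLin'
            ((T * F - ζ₀ • (1 : Matrix (Fin d) (Fin d) ℂ)) ^ 2))) = 1 := by
  have key : ∀ (M : Matrix (Fin d) (Fin d) ℂ) (x : EuclideanSpace ℂ (Fin d)),
      Matrix.toEuclideanLin M x = WithLp.toLp 2 (M.mulVec x.ofLp) := fun M x => rfl
  have hmul : ∀ x : EuclideanSpace ℂ (Fin d), Matrix.toEuclideanLin (T * F) x =
      Matrix.toEuclideanLin T (Matrix.toEuclideanLin F x) := by
    intro x
    rw [key, key, key, ← Matrix.mulVec_mulVec]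
  obtain ⟨ζ₀, h1, h2, h3, u, hu, h4⟩ := main_abs (Matrix.toEuclideanLin F)
    (Matrix.toEuclideanLin T) (Matrix.isHermitian_iff_isSymmetric.1 hF)
    (Matrix.isHermitian_iff_isSymmetric.1 hT) ε₁ ε₂ ε₃ hε₁ hε₂ hε₃ hεs
    (matOpNorm_bound T hTnorm)
    (fun μ ⟨v, hv, hv2⟩ => hspec μ ⟨v.ofLp, by simpa using hv, congrArg WithLp.ofLp hv2⟩)
    (WithLp.toLp 2 fp) (WithLp.toLp 2 fm)
    (by rw [key, hfp]) (by rw [key, hfm]; rfl)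
    (by rw [← evnorm_eq, hfpnorm]) (by rw [← evnorm_eq, hfmnorm])
    (fun v hv => by
      obtain ⟨c, hc⟩ := hkerp v.ofLp (congrArg WithLp.ofLp hv)
      exact ⟨c, congrArg (WithLp.toLp 2) hc⟩)
    (fun v hv => by
      obtain ⟨c, hc⟩ := hkerm v.ofLp (congrArg WithLp.ofLp hv)
      exact ⟨c, congrArg (WithLp.toLp 2) hc⟩)
    (by rw [key, ← evnorm_eq]; exact hTfp)
    (by
      rw [key, ← WithLp.toLp_add, ← evnorm_eq]
      rw [Matrix.add_mulVec, Matrix.one_mulVec] at hTfm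
      exact hTfm)
  refine ⟨ζ₀, ⟨h1, ?_⟩, ?_, ?_⟩
  · rw [not_isUnit_iff]
    simpa only [hmul] using h2
  · intro ζ hζ hζ2
    rw [not_isUnit_iff] at hζ2
    apply h3 ζ hζ
    simpa only [hmul] using hζ2
  · have hk : LinearMap.ker (Matrix.toLin'
            ((T * F - ζ₀ • (1 : Matrix (Fin d) (Fin d) ℂ)) ^ 2)) = Submodule.span ℂ {u.ofLp} := by
      ext w
      rw [LinearMap.mem_ker, Submodule.mem_span_singleton, Matrix.toLin'_apply, pow_two,
        ← Matrix.mulVec_mulVec]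
      have e1 : ∀ w : Fin d → ℂ, (T * F - ζ₀ • (1 : Matrix (Fin d) (Fin d) ℂ)).mulVec w =
          (Matrix.toEuclideanLin T (Matrix.toEuclideanLin F (WithLp.toLp 2 w)) -
            ζ₀ • WithLp.toLp 2 w).ofLp := by
        intro w
        rw [← hmul, key, Matrix.sub_mulVec, Matrix.smul_mulVec, Matrix.one_mulVec]; rfl
      have h5 := h4 (WithLp.toLp 2 w)
      rw [e1, e1 w, WithLp.toLp_ofLp]
      constructor
      · intro h
        obtain ⟨c, hc⟩ := h5.1 (congrArg (WithLp.toLp 2) h)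
        exact ⟨c, (congrArg WithLp.ofLp hc).symm⟩
      · rintro ⟨c, hc⟩
        exact congrArg WithLp.ofLp (h5.2 ⟨c, congrArg (WithLp.toLp 2) hc.symm⟩)
    rw [hk]
    exact finrank_span_singleton (by simpa using hu)
end

section
/- Let n ≥ 1, X ∈ Matrix n n ℂ, and z ∈ ℂ with z ∉ ℝ. Then the 2n × 2n block matrix R := fromBlocks (z·1) X Xᴴ (z·1) (with n×n blocks, where 1 is the n×n identity and Xᴴ the conjugate transpose of X) is invertible, and the trace of the upper-left n×n block of R⁻¹ equals the trace of the lower-right n×n block of R⁻¹. -/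
open Matrix

/-- Lemma C.6 of the paper: for `z ∉ ℝ`, the resolvent of the Hermitization,
`(fromBlocks (z·1) X Xᴴ (z·1))⁻¹`, exists and lies in the hyperplane `E₋^⊥`, i.e. the
traces of its two diagonal `n×n` blocks coincide. -/
theorem hermitization_resolvent_in_Eminus_perp
    (n : ℕ) (hn : 1 ≤ n) (X : Matrix (Fin n) (Fin n) ℂ)
    (z : ℂ) (hz : z.im ≠ 0) :
    IsUnit (Matrix.fromBlocks (z • (1 : Matrix (Fin n) (Fin n) ℂ)) X
        Xᴴ (z • (1 : Matrix (Fin n) (Fin n) ℂ)))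
      ∧ Matrix.trace
          ((Matrix.fromBlocks (z • (1 : Matrix (Fin n) (Fin n) ℂ)) X
            Xᴴ (z • (1 : Matrix (Fin n) (Fin n) ℂ)))⁻¹.toBlocks₁₁)
        = Matrix.trace
          ((Matrix.fromBlocks (z • (1 : Matrix (Fin n) (Fin n) ℂ)) X
            Xᴴ (z • (1 : Matrix (Fin n) (Fin n) ℂ)))⁻¹.toBlocks₂₂) := by
  have hU : IsUnit (Matrix.fromBlocks (z • (1 : Matrix (Fin n) (Fin n) ℂ)) X
        Xᴴ (z • (1 : Matrix (Fin n) (Fin n) ℂ))) := by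
    have hH : (Matrix.fromBlocks (0 : Matrix (Fin n) (Fin n) ℂ) X Xᴴ 0).IsHermitian := by
      simp [Matrix.IsHermitian, Matrix.fromBlocks_conjTranspose]
    have hR : Matrix.fromBlocks (z • (1 : Matrix (Fin n) (Fin n) ℂ)) X
        Xᴴ (z • (1 : Matrix (Fin n) (Fin n) ℂ))
        = z • (1 : Matrix (Fin n ⊕ Fin n) (Fin n ⊕ Fin n) ℂ)
          + Matrix.fromBlocks (0 : Matrix (Fin n) (Fin n) ℂ) X Xᴴ 0 := by
      rw [← Matrix.fromBlocks_one, Matrix.fromBlocks_smul, Matrix.fromBlocks_add]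
      simp
    rw [hR, Matrix.isUnit_iff_isUnit_det, isUnit_iff_ne_zero]
    intro hdet
    obtain ⟨v, hv, h0⟩ := Matrix.exists_mulVec_eq_zero_iff.mpr hdet
    have h1 := congrArg (fun w => star v ⬝ᵥ w) h0
    simp only [Matrix.add_mulVec, Matrix.smul_mulVec, Matrix.one_mulVec, dotProduct_add,
      dotProduct_smul, dotProduct_zero, smul_eq_mul] at h1
    have h2 := hH.im_star_dotProduct_mulVec_self v
    have h3 := Matrix.isHermitian_one.im_star_dotProduct_mulVec_self (𝕜 := ℂ) v
    rw [Matrix.one_mulVec] at h3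
    have h4 := congrArg Complex.im h1
    simp only [RCLike.im_to_complex] at h2 h3
    simp only [Complex.add_im, Complex.mul_im, h2, h3, Complex.zero_im, mul_zero, zero_add,
      add_zero] at h4
    have h5 := (mul_eq_zero.mp h4).resolve_left hz
    have h6 : star v ⬝ᵥ v = 0 := Complex.ext h5 h3
    open scoped ComplexOrder in
    exact hv (dotProduct_star_self_eq_zero.mp h6)
  refine ⟨hU, ?_⟩
  have hz0 : z ≠ 0 := fun h => hz (by simp [h])
  have hd := (Matrix.isUnit_iff_isUnit_det _).mp hU
  have e1 := Matrix.mul_nonsing_inv _ hd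
  have e2 := Matrix.nonsing_inv_mul _ hd
  generalize (Matrix.fromBlocks (z • (1 : Matrix (Fin n) (Fin n) ℂ)) X
        Xᴴ (z • (1 : Matrix (Fin n) (Fin n) ℂ)))⁻¹ = S at e1 e2 ⊢
  rw [← Matrix.fromBlocks_toBlocks S, Matrix.fromBlocks_multiply, ← Matrix.fromBlocks_one,
    Matrix.fromBlocks_inj] at e1 e2
  have a := congrArg Matrix.trace e1.2.2.2
  have b := congrArg Matrix.trace e2.1
  simp only [Matrix.trace_add, Matrix.smul_mul, Matrix.mul_smul, Matrix.one_mul, Matrix.mul_one,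
    Matrix.trace_smul, smul_eq_mul] at a b
  rw [Matrix.trace_mul_comm] at a
  apply mul_left_cancel₀ hz0
  linear_combination b - a
end

section
/- Let n ≥ 1, X ∈ Matrix n n ℂ, and z ∈ ℂ with z ∉ ℝ. Then the matrices z²·1 − X·Xᴴ and z²·1 − Xᴴ·X are invertible, the block matrix R := fromBlocks (z·1) X Xᴴ (z·1) is invertible, and R⁻¹ = fromBlocks ( z·(z²·1 − X·Xᴴ)⁻¹ ) ( −(z²·1 − X·Xᴴ)⁻¹·X ) ( −Xᴴ·(z²·1 − X·Xᴴ)⁻¹ ) ( z·(z²·1 − Xᴴ·X)⁻¹ ). -/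
open Matrix

open scoped ComplexOrder in
lemma isUnit_sq_sub_aux (n : ℕ) (A : Matrix (Fin n) (Fin n) ℂ) (hA : A.PosSemidef)
    (z : ℂ) (hz : z.im ≠ 0) :
    IsUnit (z ^ 2 • (1 : Matrix (Fin n) (Fin n) ℂ) - A) := by
  by_contra h
  have h1 : z ^ 2 ∈ spectrum ℂ A := by
    rw [spectrum.mem_iff, Algebra.algebraMap_eq_smul_one]
    exact h
  rw [hA.isHermitian.spectrum_eq_image_range] at h1
  obtain ⟨_, ⟨i, rfl⟩, hi⟩ := h1
  have h0 := hA.eigenvalues_nonneg i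
  have hre := congrArg Complex.re hi
  have him := congrArg Complex.im hi
  simp [pow_two] at hre him
  have hzr : z.re = 0 := by
    have : z.re * z.im = 0 := by linarith
    exact (mul_eq_zero.mp this).resolve_right hz
  rw [hzr] at hre
  have := mul_self_pos.mpr hz
  linarith

/-- The Schur complement formula (C.16) for the resolvent of the Hermitization: for
`z ∉ ℝ`, `(fromBlocks (z·1) X Xᴴ (z·1))⁻¹` is given explicitly in terms of
`(z²·1 − X·Xᴴ)⁻¹` and `(z²·1 − Xᴴ·X)⁻¹`. -/
theorem hermitization_resolvent_schur_formula
    (n : ℕ) (hn : 1 ≤ n) (X : Matrix (Fin n) (Fin n) ℂ)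
    (z : ℂ) (hz : z.im ≠ 0) :
    IsUnit (z ^ 2 • (1 : Matrix (Fin n) (Fin n) ℂ) - X * Xᴴ)
      ∧ IsUnit (z ^ 2 • (1 : Matrix (Fin n) (Fin n) ℂ) - Xᴴ * X)
      ∧ IsUnit (Matrix.fromBlocks (z • (1 : Matrix (Fin n) (Fin n) ℂ)) X
          Xᴴ (z • (1 : Matrix (Fin n) (Fin n) ℂ)))
      ∧ (Matrix.fromBlocks (z • (1 : Matrix (Fin n) (Fin n) ℂ)) X
          Xᴴ (z • (1 : Matrix (Fin n) (Fin n) ℂ)))⁻¹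
        = Matrix.fromBlocks
            (z • (z ^ 2 • (1 : Matrix (Fin n) (Fin n) ℂ) - X * Xᴴ)⁻¹)
            (-((z ^ 2 • (1 : Matrix (Fin n) (Fin n) ℂ) - X * Xᴴ)⁻¹ * X))
            (-(Xᴴ * (z ^ 2 • (1 : Matrix (Fin n) (Fin n) ℂ) - X * Xᴴ)⁻¹))
            (z • (z ^ 2 • (1 : Matrix (Fin n) (Fin n) ℂ) - Xᴴ * X)⁻¹) := by
  open scoped ComplexOrder in
  have hA := isUnit_sq_sub_aux n _ (Matrix.posSemidef_self_mul_conjTranspose X) z hz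
  open scoped ComplexOrder in
  have hB := isUnit_sq_sub_aux n _ (Matrix.posSemidef_conjTranspose_mul_self X) z hz
  have hAX : (z ^ 2 • (1 : Matrix (Fin n) (Fin n) ℂ) - X * Xᴴ) * X
      = X * (z ^ 2 • (1 : Matrix (Fin n) (Fin n) ℂ) - Xᴴ * X) := by
    simp [sub_mul, mul_sub, Matrix.mul_assoc]
  have eA : z ^ 2 • (1 : Matrix (Fin n) (Fin n) ℂ)
      = (z ^ 2 • (1 : Matrix (Fin n) (Fin n) ℂ) - X * Xᴴ) + X * Xᴴ := by simp
  have eB : z ^ 2 • (1 : Matrix (Fin n) (Fin n) ℂ)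
      = (z ^ 2 • (1 : Matrix (Fin n) (Fin n) ℂ) - Xᴴ * X) + Xᴴ * X := by simp
  refine ⟨hA, hB, ?_⟩
  generalize z ^ 2 • (1 : Matrix (Fin n) (Fin n) ℂ) - X * Xᴴ = A at *
  generalize z ^ 2 • (1 : Matrix (Fin n) (Fin n) ℂ) - Xᴴ * X = B at *
  rw [Matrix.isUnit_iff_isUnit_det] at hA hB
  have hc : A⁻¹ * X = X * B⁻¹ := by
    calc A⁻¹ * X = A⁻¹ * (X * B) * B⁻¹ := by
          rw [Matrix.mul_assoc, Matrix.mul_assoc, Matrix.mul_nonsing_inv _ hB, Matrix.mul_one]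
      _ = X * B⁻¹ := by
          rw [← hAX, ← Matrix.mul_assoc, Matrix.nonsing_inv_mul _ hA, Matrix.one_mul]
  have key : Matrix.fromBlocks (z • (1 : Matrix (Fin n) (Fin n) ℂ)) X
          Xᴴ (z • (1 : Matrix (Fin n) (Fin n) ℂ)) *
      Matrix.fromBlocks (z • A⁻¹) (-(A⁻¹ * X)) (-(Xᴴ * A⁻¹)) (z • B⁻¹) = 1 := by
    rw [Matrix.fromBlocks_multiply, ← Matrix.fromBlocks_one]
    congr 1
    · have : z ^ 2 • A⁻¹ = 1 + X * Xᴴ * A⁻¹ := by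
        have := congrArg (· * A⁻¹) eA
        simpa [add_mul, Matrix.mul_nonsing_inv _ hA] using this
      simp [smul_smul, ← pow_two, this, Matrix.mul_assoc]
    · simp [hc]
    · simp
    · have : z ^ 2 • B⁻¹ = 1 + Xᴴ * X * B⁻¹ := by
        have := congrArg (· * B⁻¹) eB
        simpa [add_mul, Matrix.mul_nonsing_inv _ hB] using this
      simp [smul_smul, ← pow_two, this, hc, Matrix.mul_assoc]
  exact ⟨IsUnit.of_mul_eq_one _ key, Matrix.inv_eq_right_inv key⟩
end
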